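/- For every ε > 0 there exists a constant C = C(ε) such that for every λ > 1 and every point ζ ∈ ℝ³, the number of lattice points in the cap of radius λ^{1/4}, i.e. the cardinality of {n ∈ ℤ³ : |n| = λ, |n − ζ| ≤ λ^{1/4}}, is at most C·λ^ε. -/

import Mathlib

lemma div_bound (ε : ℝ) (hε : 0 < ε) :
    ∃ C : ℝ, 1 ≤ C ∧ ∀ n : ℕ, n ≠ 0 → (n.divisors.card : ℝ) ≤ C * (n : ℝ) ^ ε := by
  obtain ⟨P, hP⟩ := exists_nat_ge ((2 : ℝ) ^ (1 / ε))
  have hl2 : 0 < Real.log 2 := Real.log_pos (by norm_num)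
  set K : ℝ := 1 + 1 / (ε * Real.log 2) with hK
  have hK1 : 1 ≤ K := by
    have : 0 < 1 / (ε * Real.log 2) := by positivity
    linarith
  refine ⟨K ^ P, one_le_pow₀ hK1, fun n hn => ?_⟩
  have key : ∀ p ∈ n.primeFactors, ((n.factorization p + 1 : ℕ) : ℝ) ≤
      (if p < P then K else 1) * ((p : ℝ) ^ (n.factorization p)) ^ ε := by
    intro p hp
    have hp2 : (2 : ℝ) ≤ p := by exact_mod_cast (Nat.prime_of_mem_primeFactors hp).two_le
    have hp0 : (0 : ℝ) < p := by linarith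
    generalize n.factorization p = a
    have e1 : ((p : ℝ) ^ a) ^ ε = ((p : ℝ) ^ ε) ^ a := by
      rw [← Real.rpow_natCast, ← Real.rpow_natCast, ← Real.rpow_mul hp0.le, ← Real.rpow_mul hp0.le,
        mul_comm]
    split_ifs with h
    · have h1 : 1 + a * (ε * Real.log 2) ≤ ((p : ℝ) ^ a) ^ ε := by
        have h2 : ((p : ℝ) ^ a) ^ ε = Real.exp (a * (ε * Real.log p)) := by
          rw [e1, Real.rpow_def_of_pos hp0, ← Real.exp_nat_mul]
          ring_nf
        rw [h2]
        have h3 : Real.log 2 ≤ Real.log p := Real.log_le_log (by norm_num) hp2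
        have h4 : (a : ℝ) * (ε * Real.log 2) ≤ a * (ε * Real.log p) := by gcongr
        linarith [Real.add_one_le_exp ((a : ℝ) * (ε * Real.log p))]
      calc ((a + 1 : ℕ) : ℝ) ≤ K * (1 + a * (ε * Real.log 2)) := by
            have h0 : 0 < ε * Real.log 2 := by positivity
            rw [hK]
            generalize ε * Real.log 2 = t at *
            have : (1 + 1 / t) * (1 + a * t) = 1 + a + a * t + 1 / t := by field_simp; ring
            rw [this]; push_cast
            have : 0 ≤ a * t := by positivity
            have : 0 < 1 / t := by positivity
            linarith
        _ ≤ _ := by gcongr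
    · rw [one_mul, e1]
      have h1 : (2 : ℝ) ≤ (p : ℝ) ^ ε := by
        have : (2 : ℝ) ^ (1 / ε) ≤ p := hP.trans (by exact_mod_cast not_lt.mp h)
        calc (2 : ℝ) = ((2 : ℝ) ^ (1 / ε)) ^ ε := by
              rw [← Real.rpow_mul (by norm_num)]; field_simp; simp
          _ ≤ _ := by gcongr
      calc ((a + 1 : ℕ) : ℝ) ≤ (2 : ℝ) ^ a := by exact_mod_cast Nat.lt_two_pow_self
        _ ≤ _ := by gcongr
  rw [Nat.card_divisors hn]
  push_cast at key ⊢
  calc ∏ p ∈ n.primeFactors, ((n.factorization p : ℝ) + 1)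
      ≤ ∏ p ∈ n.primeFactors, ((if p < P then K else 1) * ((p : ℝ) ^ (n.factorization p)) ^ ε) :=
        Finset.prod_le_prod (fun _ _ => by positivity) key
    _ = (∏ p ∈ n.primeFactors, (if p < P then K else 1)) *
        (∏ p ∈ n.primeFactors, (p : ℝ) ^ (n.factorization p)) ^ ε := by
        rw [Finset.prod_mul_distrib, Real.finsetProd_rpow _ _ (fun _ _ => by positivity)]
    _ ≤ _ := by
        have h1 : (∏ p ∈ n.primeFactors, (p : ℝ) ^ (n.factorization p)) = n := by
          conv_rhs => rw [← Nat.prod_factorization_pow_eq_self hn]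
          rw [Finsupp.prod, Nat.support_factorization]
          push_cast; rfl
        rw [h1]
        gcongr
        rw [← Finset.prod_filter, Finset.prod_const]
        apply pow_le_pow_right₀ hK1
        calc _ ≤ (Finset.range P).card := Finset.card_le_card (by
              intro p; simp)
          _ = P := by simp

lemma pairB (m e e' x0 y0 x1 y1 x2 y2 : ℤ) (hm : m = e * e')
    (hx1 : IsCoprime x1 m) (hy0 : IsCoprime y0 m)
    (h1 : e ∣ x1 * y0 - x0 * y1) (h1' : e' ∣ x1 * y0 + x0 * y1)
    (h2 : e ∣ x2 * y0 - x0 * y2) (h2' : e' ∣ x2 * y0 + x0 * y2) :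
    m ∣ 2 * (x1 * y2 - x2 * y1) := by
  have hye : IsCoprime e y0 := (hy0.of_isCoprime_of_dvd_right ⟨e', hm⟩).symm
  have hye' : IsCoprime e' y0 := (hy0.of_isCoprime_of_dvd_right ⟨e, by rw [hm]; ring⟩).symm
  have hxe : IsCoprime e x1 := (hx1.of_isCoprime_of_dvd_right ⟨e', hm⟩).symm
  have b1 : e ∣ x1 * y2 - x2 * y1 := by
    apply hye.dvd_of_dvd_mul_left
    have := dvd_sub (h1.mul_right y2) (h2.mul_right y1)
    convert this using 1; ring
  have b2 : e' ∣ x1 * y2 - x2 * y1 := by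
    apply hye'.dvd_of_dvd_mul_left
    have := dvd_sub (h1'.mul_right y2) (h2'.mul_right y1)
    convert this using 1; ring
  have hf : gcd e e' ∣ 2 := by
    have d1 : gcd e e' ∣ e := gcd_dvd_left _ _
    have d2 : gcd e e' ∣ e' := gcd_dvd_right _ _
    have : gcd e e' ∣ y0 * (x1 * 2) := by
      have h3 := dvd_add (d1.trans h1) (d2.trans h1')
      have h4 : x1 * y0 - x0 * y1 + (x1 * y0 + x0 * y1) = y0 * (x1 * 2) := by ring
      rwa [h4] at h3
    have := (hye.of_isCoprime_of_dvd_left d1).dvd_of_dvd_mul_left this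
    exact (hxe.of_isCoprime_of_dvd_left d1).dvd_of_dvd_mul_left this
  have hl : lcm e e' ∣ x1 * y2 - x2 * y1 := lcm_dvd b1 b2
  have : e * e' ∣ gcd e e' * lcm e e' := (gcd_mul_lcm e e').symm.dvd
  rw [hm]
  exact this.trans (mul_dvd_mul hf hl)

lemma formA (a b : ℤ) (m : ℕ) (ha : 0 < a) (hb : 0 < b) (hm : 0 < m) (ham : IsCoprime a m)
    (s : Finset (ℤ × ℤ))
    (hs : ∀ p ∈ s, a * p.1 ^ 2 + b * p.2 ^ 2 = m ∧ IsCoprime p.1 m ∧ IsCoprime p.2 m) :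
    s.card ≤ 10 * m.divisors.card := by
  rcases s.eq_empty_or_nonempty with rfl | ⟨⟨x0, y0⟩, h0⟩
  · simp
  obtain ⟨q0, cx0, cy0⟩ := hs _ h0
  simp only at q0 cx0 cy0
  have hmz : (0 : ℤ) < m := by exact_mod_cast hm
  apply Finset.card_le_mul_card_image_of_maps_to (f := fun p => Int.gcd m (p.1 * y0 - x0 * p.2))
  · intro p _
    rw [Nat.mem_divisors]
    exact ⟨Int.gcd_dvd_natAbs_left _ _, hm.ne'⟩
  intro e he
  obtain ⟨e', hee⟩ := (Nat.mem_divisors.mp he).1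
  have hez : (m : ℤ) = e * e' := by exact_mod_cast hee
  have he0 : (e : ℤ) ≠ 0 := by rintro h; rw [h] at hez; simp at hez; omega
  set t := s.filter (fun p => Int.gcd m (p.1 * y0 - x0 * p.2) = e) with ht
  have hd : ∀ p ∈ t, (e : ℤ) ∣ p.1 * y0 - x0 * p.2 ∧ (e' : ℤ) ∣ p.1 * y0 + x0 * p.2 := by
    rintro ⟨x, y⟩ hp
    rw [ht, Finset.mem_filter] at hp
    obtain ⟨hp, hg⟩ := hp
    obtain ⟨q, cx, cy⟩ := hs _ hp
    simp only at q cx cy hg ⊢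
    constructor
    · rw [← hg]; exact Int.gcd_dvd_right _ _
    have h1 : (m : ℤ) ∣ (x * y0 - x0 * y) * (x * y0 + x0 * y) := by
      apply ham.symm.dvd_of_dvd_mul_left
      refine ⟨y0 ^ 2 - y ^ 2, ?_⟩
      linear_combination y0 ^ 2 * q - y ^ 2 * q0
    have h2 := dvd_gcd_mul_of_dvd_mul h1
    rw [← Int.coe_gcd, hg] at h2
    nth_rewrite 1 [hez] at h2
    exact Int.dvd_of_mul_dvd_mul_left he0 h2
  rcases t.eq_empty_or_nonempty with h | ⟨⟨x1, y1⟩, h1⟩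
  · simp [h]
  have hts : ∀ p ∈ t, p ∈ s := fun p hp => (Finset.mem_filter.mp hp).1
  obtain ⟨q1, cx1, cy1⟩ := hs _ (hts _ h1)
  obtain ⟨d1, d1'⟩ := hd _ h1
  simp only at q1 cx1 cy1 d1 d1'
  have hB : ∀ p ∈ t, ∃ k : ℤ, k ∈ Finset.Icc (-2 : ℤ) 2 ∧ 2 * (x1 * p.2 - p.1 * y1) = m * k := by
    rintro ⟨x, y⟩ hp
    obtain ⟨q, cx, cy⟩ := hs _ (hts _ hp)
    obtain ⟨d, d'⟩ := hd _ hp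
    simp only at q cx cy d d' ⊢
    obtain ⟨k, hk⟩ := pairB m e e' x0 y0 x1 y1 x y hez cx1 cy0 d1 d1' d d'
    refine ⟨k, ?_, hk⟩
    have hid : (a * x1 * x + b * y1 * y) ^ 2 + a * b * (x1 * y - x * y1) ^ 2 = (m : ℤ) ^ 2 := by
      have : (m : ℤ) ^ 2 = (a * x1 ^ 2 + b * y1 ^ 2) * (a * x ^ 2 + b * y ^ 2) := by
        rw [q1, q]; ring
      rw [this]; ring
    have hab : 1 ≤ a * b := Int.mul_pos ha hb
    have h3 : (x1 * y - x * y1) ^ 2 ≤ (m : ℤ) ^ 2 := by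
      nlinarith [sq_nonneg (a * x1 * x + b * y1 * y), sq_nonneg (x1 * y - x * y1)]
    have h4 : (m : ℤ) ^ 2 * k ^ 2 ≤ (m : ℤ) ^ 2 * 4 := by
      have : (m : ℤ) ^ 2 * k ^ 2 = 4 * (x1 * y - x * y1) ^ 2 := by
        rw [← mul_pow, ← hk]; ring
      linarith
    have h5 : k ^ 2 ≤ 4 := le_of_mul_le_mul_left h4 (by positivity)
    rw [Finset.mem_Icc]
    constructor <;> nlinarith
  choose! k hk1 hk2 using hB
  have : t.card ≤ (Finset.Icc (-2 : ℤ) 2 ×ˢ (Finset.univ : Finset Bool)).card := by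
    apply Finset.card_le_card_of_injOn
      (fun p => (k p, decide (0 ≤ a * x1 * p.1 + b * y1 * p.2)))
    · intro p hp
      exact Finset.mem_product.mpr ⟨hk1 p hp, Finset.mem_univ _⟩
    · rintro ⟨x, y⟩ hp ⟨x', y'⟩ hp' heq
      have hp : (x, y) ∈ t := hp
      have hp' : (x', y') ∈ t := hp'
      have e1 := hk2 _ hp
      have e2 := hk2 _ hp'
      simp only [Prod.mk.injEq, decide_eq_decide] at heq
      rw [← heq.1, ← e1] at e2
      have eB : x1 * y' - x' * y1 = x1 * y - x * y1 := by simpa using e2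
      have q := (hs _ (hts _ hp)).1
      have q' := (hs _ (hts _ hp')).1
      simp only at q q' 
      have hA : (a * x1 * x + b * y1 * y) ^ 2 = (a * x1 * x' + b * y1 * y') ^ 2 := by
        have i1 : (a * x1 * x + b * y1 * y) ^ 2 + a * b * (x1 * y - x * y1) ^ 2 = (m : ℤ) * m := by
          nth_rewrite 1 [← q1]; rw [← q]; ring
        have i2 : (a * x1 * x' + b * y1 * y') ^ 2 + a * b * (x1 * y' - x' * y1) ^ 2 = (m : ℤ) * m := by
          nth_rewrite 1 [← q1]; rw [← q']; ring
        rw [eB] at i2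
        linarith
      have hA' : a * x1 * x + b * y1 * y = a * x1 * x' + b * y1 * y' := by
        rcases sq_eq_sq_iff_eq_or_eq_neg.mp hA with h | h
        · exact h
        · have := heq.2
          by_cases hc : 0 ≤ a * x1 * x + b * y1 * y
          · have := this.mp hc; linarith
          · have h6 := mt this.mpr hc; push Not at hc h6; linarith
      have ex : (m : ℤ) * x = m * x' := by
        rw [← q1]; linear_combination x1 * hA' + b * y1 * eB
      have ey : (m : ℤ) * y = m * y' := by
        rw [← q1]; linear_combination y1 * hA' - a * x1 * eB
      rw [Prod.mk.injEq]
      exact ⟨mul_left_cancel₀ hmz.ne' ex, mul_left_cancel₀ hmz.ne' ey⟩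
  simpa using this

lemma formB (a b : ℤ) (m : ℕ) (ha : 0 < a) (hb : 0 < b) (hm : 0 < m)
    (s : Finset (ℤ × ℤ))
    (hs : ∀ p ∈ s, a * p.1 ^ 2 + b * p.2 ^ 2 = m ∧ IsCoprime p.1 m ∧ IsCoprime p.2 m) :
    s.card ≤ 10 * m.divisors.card := by
  rcases s.eq_empty_or_nonempty with rfl | ⟨⟨x0, y0⟩, h0⟩
  · simp
  obtain ⟨q0, cx0, cy0⟩ := hs _ h0
  simp only at q0 cx0 cy0
  set h : ℕ := Int.gcd a m with hh
  have hpos : 0 < h := Int.gcd_pos_of_ne_zero_left _ ha.ne'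
  have hz : (0 : ℤ) < h := by exact_mod_cast hpos
  have da : (h : ℤ) ∣ a := Int.gcd_dvd_left _ _
  have dm : (h : ℤ) ∣ m := Int.gcd_dvd_right _ _
  have db : (h : ℤ) ∣ b := by
    have c1 : IsCoprime (h : ℤ) (y0 ^ 2) := ((cy0.of_isCoprime_of_dvd_right dm).symm).pow_right
    apply c1.dvd_of_dvd_mul_right
    have : b * y0 ^ 2 = m - a * x0 ^ 2 := by linarith
    rw [this]
    exact dvd_sub dm (da.mul_right _)
  have hcop : Int.gcd (a / h) (m / h) = 1 := Int.gcd_ediv_gcd_ediv_gcd_of_ne_zero_left ha.ne'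
  clear hh
  clear_value h
  obtain ⟨a', rfl⟩ := da
  obtain ⟨b', rfl⟩ := db
  have dmn : h ∣ m := by exact_mod_cast dm
  obtain ⟨m', hm'⟩ := dmn
  have hmz : (m : ℤ) = h * m' := by exact_mod_cast hm'
  have hm'0 : 0 < m' := by
    rcases Nat.eq_zero_or_pos m' with h | h
    · subst h; simp at hm'; omega
    · exact h
  rw [hmz, Int.mul_ediv_cancel_left _ hz.ne', Int.mul_ediv_cancel_left _ hz.ne'] at hcop
  have hA := formA a' b' m' (pos_of_mul_pos_right ha hz.le) (pos_of_mul_pos_right hb hz.le) hm'0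
    (Int.isCoprime_iff_gcd_eq_one.mpr hcop) s (by
      intro p hp
      obtain ⟨q, cx, cy⟩ := hs _ hp
      have dd : (m' : ℤ) ∣ m := ⟨h, by rw [hmz]; ring⟩
      refine ⟨?_, cx.of_isCoprime_of_dvd_right dd, cy.of_isCoprime_of_dvd_right dd⟩
      apply mul_left_cancel₀ hz.ne'
      rw [← hmz, ← q]; ring)
  refine hA.trans ?_
  gcongr
  exact ⟨h, by rw [hm']; ring⟩

lemma formC (D : ℤ) (N : ℕ) (hD : 0 < D) (hN : 0 < N) (s : Finset (ℤ × ℤ))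
    (hs : ∀ p ∈ s, p.1 ^ 2 + D * p.2 ^ 2 = N ∧ IsCoprime p.1 p.2) :
    s.card ≤ 10 * N.divisors.card * N.divisors.card := by
  apply Finset.card_le_mul_card_image_of_maps_to (f := fun p => Int.gcd p.1 N)
  · intro p _
    rw [Nat.mem_divisors]
    exact ⟨Int.gcd_dvd_natAbs_right _ _, hN.ne'⟩
  intro g hg
  obtain ⟨m, hm⟩ := (Nat.mem_divisors.mp hg).1
  have hg0 : 0 < g := Nat.pos_of_mem_divisors hg
  have hgz : (0 : ℤ) < g := by exact_mod_cast hg0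
  have hmz : (N : ℤ) = g * m := by exact_mod_cast hm
  have hm0 : 0 < m := by
    rcases Nat.eq_zero_or_pos m with h | h
    · subst h; simp at hm; omega
    · exact h
  set t := s.filter (fun p => Int.gcd p.1 N = g) with ht
  have hts : ∀ p ∈ t, p ∈ s ∧ Int.gcd p.1 N = g := fun p hp => (Finset.mem_filter.mp hp)
  have hdv : ∀ p ∈ t, p.1 = g * (p.1 / g) := by
    intro p hp
    have : (g : ℤ) ∣ p.1 := by rw [← (hts p hp).2]; exact Int.gcd_dvd_left _ _
    exact (Int.mul_ediv_cancel' this).symm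
  rcases t.eq_empty_or_nonempty with h | ⟨⟨x1, y1⟩, h1⟩
  · simp [h]
  have dD : (g : ℤ) ∣ D := by
    obtain ⟨q, c⟩ := hs _ (hts _ h1).1
    have d1 : (g : ℤ) ∣ x1 := ⟨_, hdv _ h1⟩
    simp only at q c
    have c1 : IsCoprime (g : ℤ) (y1 ^ 2) := (c.of_isCoprime_of_dvd_left d1).pow_right
    apply c1.dvd_of_dvd_mul_right
    have : D * y1 ^ 2 = g * m - x1 * x1 := by linarith
    rw [this]
    exact dvd_sub (dvd_mul_right _ _) (d1.mul_right _)
  obtain ⟨d, rfl⟩ := dD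
  have hinj : Set.InjOn (fun p : ℤ × ℤ => (p.1 / (g : ℤ), p.2)) t := by
    rintro ⟨x, y⟩ hp ⟨x', y'⟩ hp' heq
    have e1 := hdv _ hp
    have e2 := hdv _ hp'
    simp only [Prod.mk.injEq] at heq e1 e2 ⊢
    exact ⟨by rw [e1, e2, heq.1], heq.2⟩
  rw [← Finset.card_image_of_injOn hinj]
  refine (formB g d m hgz (pos_of_mul_pos_right hD hgz.le) hm0 _ ?_).trans ?_
  · intro p' hp'
    obtain ⟨⟨x, y⟩, hp, rfl⟩ := Finset.mem_image.mp hp'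
    obtain ⟨q, c⟩ := hs _ (hts _ hp).1
    have hgg := (hts _ hp).2
    have e := hdv _ hp
    simp only at q c e hgg ⊢
    generalize hx : x / (g : ℤ) = x' at *
    refine ⟨?_, ?_, ?_⟩
    · apply mul_left_cancel₀ hgz.ne'
      rw [← hmz, ← q, e]; ring
    · rw [Int.isCoprime_iff_gcd_eq_one]
      rw [e, hmz, Int.gcd_mul_left] at hgg
      simp only [Int.natAbs_natCast] at hgg
      exact Nat.eq_of_mul_eq_mul_left hg0 (by rw [hgg, mul_one])
    · have : IsCoprime y (N : ℤ) := by
        rw [← q]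
        have h5 : IsCoprime y (x ^ 2 + y * (g * d * y)) := (c.symm.pow_right).add_mul_left_right _
        convert h5 using 1; ring
      exact this.of_isCoprime_of_dvd_right ⟨g, by rw [hmz]; ring⟩
  · gcongr
    exact ⟨g, by rw [hm]; ring⟩

lemma formD (D : ℤ) (N : ℕ) (hD : 0 < D) (hN : 0 < N) (s : Finset (ℤ × ℤ))
    (hs : ∀ p ∈ s, p.1 ^ 2 + D * p.2 ^ 2 = N) :
    s.card ≤ 10 * N.divisors.card * N.divisors.card * N.divisors.card := by
  have hsq : ∀ p ∈ s, (Int.gcd p.1 p.2) ^ 2 ∣ N := by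
    intro p hp
    have : ((Int.gcd p.1 p.2 : ℕ) : ℤ) ^ 2 ∣ N := by
      rw [← hs p hp]
      exact dvd_add (pow_dvd_pow_of_dvd (Int.gcd_dvd_left _ _) 2)
        ((pow_dvd_pow_of_dvd (Int.gcd_dvd_right _ _) 2).mul_left _)
    exact_mod_cast this
  apply Finset.card_le_mul_card_image_of_maps_to (f := fun p => Int.gcd p.1 p.2)
  · intro p hp
    rw [Nat.mem_divisors]
    exact ⟨(dvd_pow_self _ two_ne_zero).trans (hsq p hp), hN.ne'⟩
  intro g hg
  have hg0 : 0 < g := Nat.pos_of_mem_divisors hg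
  have hgz : (0 : ℤ) < g := by exact_mod_cast hg0
  set t := s.filter (fun p => Int.gcd p.1 p.2 = g) with ht
  have hts : ∀ p ∈ t, p ∈ s ∧ Int.gcd p.1 p.2 = g := fun p hp => (Finset.mem_filter.mp hp)
  have hdv : ∀ p ∈ t, p.1 = g * (p.1 / g) ∧ p.2 = g * (p.2 / g) := by
    intro p hp
    have h1 : (g : ℤ) ∣ p.1 := by rw [← (hts p hp).2]; exact Int.gcd_dvd_left _ _
    have h2 : (g : ℤ) ∣ p.2 := by rw [← (hts p hp).2]; exact Int.gcd_dvd_right _ _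
    exact ⟨(Int.mul_ediv_cancel' h1).symm, (Int.mul_ediv_cancel' h2).symm⟩
  rcases t.eq_empty_or_nonempty with h | ⟨p1, h1⟩
  · simp [h]
  obtain ⟨m, hm⟩ : g ^ 2 ∣ N := by
    have := hsq p1 (hts _ h1).1
    rwa [(hts _ h1).2] at this
  have hmz : (N : ℤ) = g ^ 2 * m := by exact_mod_cast hm
  have hm0 : 0 < m := by
    rcases Nat.eq_zero_or_pos m with h | h
    · subst h; simp at hm; omega
    · exact h
  have hinj : Set.InjOn (fun p : ℤ × ℤ => (p.1 / (g : ℤ), p.2 / (g : ℤ))) t := by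
    rintro ⟨x, y⟩ hp ⟨x', y'⟩ hp' heq
    have e1 := hdv _ hp
    have e2 := hdv _ hp'
    simp only [Prod.mk.injEq] at heq e1 e2 ⊢
    exact ⟨by rw [e1.1, e2.1, heq.1], by rw [e1.2, e2.2, heq.2]⟩
  rw [← Finset.card_image_of_injOn hinj]
  refine (formC D m hD hm0 _ ?_).trans ?_
  · intro p' hp'
    obtain ⟨⟨x, y⟩, hp, rfl⟩ := Finset.mem_image.mp hp'
    have q := hs _ (hts _ hp).1
    have hgg := (hts _ hp).2
    obtain ⟨e1, e2⟩ := hdv _ hp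
    simp only at q e1 e2 hgg ⊢
    generalize hx : x / (g : ℤ) = x' at *
    generalize hy : y / (g : ℤ) = y' at *
    refine ⟨?_, ?_⟩
    · apply mul_left_cancel₀ (pow_pos hgz 2).ne'
      rw [← hmz, ← q, e1, e2]; ring
    · rw [Int.isCoprime_iff_gcd_eq_one]
      rw [e1, e2, Int.gcd_mul_left] at hgg
      simp only [Int.natAbs_natCast] at hgg
      exact Nat.eq_of_mul_eq_mul_left hg0 (by rw [hgg, mul_one])
  · have : m.divisors.card ≤ N.divisors.card :=
      Finset.card_le_card (Nat.divisors_subset_of_dvd hN.ne' ⟨g ^ 2, by rw [hm]; ring⟩)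
    gcongr

lemma lagr (v1 v2 v3 w1 w2 w3 ρ : ℝ) (hv : v1 ^ 2 + v2 ^ 2 + v3 ^ 2 ≤ ρ)
    (hw : w1 ^ 2 + w2 ^ 2 + w3 ^ 2 ≤ ρ) :
    (v2 * w3 - v3 * w2) ^ 2 + (v3 * w1 - v1 * w3) ^ 2 + (v1 * w2 - v2 * w1) ^ 2 ≤ ρ ^ 2 := by
  have h1 : (v1 ^ 2 + v2 ^ 2 + v3 ^ 2) * (w1 ^ 2 + w2 ^ 2 + w3 ^ 2) ≤ ρ * ρ :=
    mul_le_mul hv hw (by positivity) (le_trans (by positivity) hv)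
  nlinarith [sq_nonneg (v1 * w1 + v2 * w2 + v3 * w3)]

lemma vec3 (α β γ p1 p2 p3 q1 q2 q3 r1 r2 r3 ρ : ℝ)
    (ha : α ^ 2 ≤ ρ ^ 2 / 4) (hb : β ^ 2 ≤ ρ ^ 2 / 4) (hc : γ ^ 2 ≤ ρ ^ 2 / 4)
    (hp : p1 ^ 2 + p2 ^ 2 + p3 ^ 2 ≤ ρ ^ 2) (hq : q1 ^ 2 + q2 ^ 2 + q3 ^ 2 ≤ ρ ^ 2)
    (hr : r1 ^ 2 + r2 ^ 2 + r3 ^ 2 ≤ ρ ^ 2) :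
    (α * p1 + β * q1 + γ * r1) ^ 2 + (α * p2 + β * q2 + γ * r2) ^ 2
      + (α * p3 + β * q3 + γ * r3) ^ 2 ≤ 9 / 4 * ρ ^ 4 := by
  have h3 : ∀ x y z : ℝ, (x + y + z) ^ 2 ≤ 3 * (x ^ 2 + y ^ 2 + z ^ 2) := fun x y z => by
    nlinarith [sq_nonneg (x - y), sq_nonneg (x - z), sq_nonneg (y - z)]
  have k1 := mul_le_mul ha hp (by positivity) (by positivity)
  have k2 := mul_le_mul hb hq (by positivity) (by positivity)
  have k3 := mul_le_mul hc hr (by positivity) (by positivity)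
  have l1 := h3 (α * p1) (β * q1) (γ * r1)
  have l2 := h3 (α * p2) (β * q2) (γ * r2)
  have l3 := h3 (α * p3) (β * q3) (γ * r3)
  linarith

lemma det_small (n1 n2 n3 u1 u2 u3 v1 v2 v3 w1 w2 w3 ρ L : ℝ)
    (hn : n1 ^ 2 + n2 ^ 2 + n3 ^ 2 = L)
    (hu' : (n1 + u1) ^ 2 + (n2 + u2) ^ 2 + (n3 + u3) ^ 2 = L)
    (hv' : (n1 + v1) ^ 2 + (n2 + v2) ^ 2 + (n3 + v3) ^ 2 = L)
    (hw' : (n1 + w1) ^ 2 + (n2 + w2) ^ 2 + (n3 + w3) ^ 2 = L)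
    (hu : u1 ^ 2 + u2 ^ 2 + u3 ^ 2 ≤ ρ) (hv : v1 ^ 2 + v2 ^ 2 + v3 ^ 2 ≤ ρ)
    (hw : w1 ^ 2 + w2 ^ 2 + w3 ^ 2 ≤ ρ) :
    (w1 * (u2 * v3 - u3 * v2) + w2 * (u3 * v1 - u1 * v3) + w3 * (u1 * v2 - u2 * v1)) ^ 2 * L
      ≤ 9 / 4 * ρ ^ 4 := by
  have hdot : ∀ x1 x2 x3 : ℝ, (n1 + x1) ^ 2 + (n2 + x2) ^ 2 + (n3 + x3) ^ 2 = L →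
      x1 ^ 2 + x2 ^ 2 + x3 ^ 2 ≤ ρ → (n1 * x1 + n2 * x2 + n3 * x3) ^ 2 ≤ ρ ^ 2 / 4 := by
    intro x1 x2 x3 h h'
    have h1 : n1 * x1 + n2 * x2 + n3 * x3 = -(x1 ^ 2 + x2 ^ 2 + x3 ^ 2) / 2 := by linarith
    rw [h1]
    have h0 : 0 ≤ x1 ^ 2 + x2 ^ 2 + x3 ^ 2 := by positivity
    nlinarith
  have := vec3 _ _ _ _ _ _ _ _ _ _ _ _ ρ (hdot _ _ _ hu' hu) (hdot _ _ _ hv' hv) (hdot _ _ _ hw' hw)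
    (lagr _ _ _ _ _ _ ρ hv hw) (lagr _ _ _ _ _ _ ρ hw hu) (lagr _ _ _ _ _ _ ρ hu hv)
  refine le_trans (le_of_eq ?_) this
  rw [← hn]; ring

lemma gram (n1 n2 n3 a1 a2 a3 u1 u2 u3 : ℤ) (h : a1 * u1 + a2 * u2 + a3 * u3 = 0) :
    (n1 * (a2 * u3 - a3 * u2) + n2 * (a3 * u1 - a1 * u3) + n3 * (a1 * u2 - a2 * u1)) ^ 2
      + (a1 ^ 2 + a2 ^ 2 + a3 ^ 2) * (n1 * u1 + n2 * u2 + n3 * u3) ^ 2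
      = (u1 ^ 2 + u2 ^ 2 + u3 ^ 2) * ((a1 ^ 2 + a2 ^ 2 + a3 ^ 2) * (n1 ^ 2 + n2 ^ 2 + n3 ^ 2)
        - (n1 * a1 + n2 * a2 + n3 * a3) ^ 2) := by
  linear_combination (2 * (n1 * a1 + n2 * a2 + n3 * a3) * (n1 * u1 + n2 * u2 + n3 * u3)
    - (n1 ^ 2 + n2 ^ 2 + n3 ^ 2) * (a1 * u1 + a2 * u2 + a3 * u3)) * h

lemma sq3 {a b c : ℤ} (h : a ^ 2 + b ^ 2 + c ^ 2 = 0) : a = 0 ∧ b = 0 ∧ c = 0 := by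
  refine ⟨?_, ?_, ?_⟩ <;> rw [← sq_eq_zero_iff] <;> nlinarith [sq_nonneg a, sq_nonneg b, sq_nonneg c]

lemma sqD {D x y : ℤ} (hD : 0 < D) (h : x ^ 2 + D * y ^ 2 = 0) : x = 0 ∧ y = 0 := by
  have h1 := sq_nonneg x
  have h2 : 0 ≤ D * y ^ 2 := by positivity
  have h3 : D * y ^ 2 = 0 := by linarith
  have h4 : x ^ 2 = 0 := by linarith
  exact ⟨pow_eq_zero_iff two_ne_zero |>.mp h4,
    pow_eq_zero_iff two_ne_zero |>.mp ((mul_eq_zero.mp h3).resolve_left hD.ne')⟩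

lemma noncol (n1 n2 n3 u1 u2 u3 v1 v2 v3 L : ℤ)
    (hn : n1 ^ 2 + n2 ^ 2 + n3 ^ 2 = L)
    (hu' : (n1 + u1) ^ 2 + (n2 + u2) ^ 2 + (n3 + u3) ^ 2 = L)
    (hv' : (n1 + v1) ^ 2 + (n2 + v2) ^ 2 + (n3 + v3) ^ 2 = L)
    (hu : u1 ^ 2 + u2 ^ 2 + u3 ^ 2 ≠ 0) (hv : v1 ^ 2 + v2 ^ 2 + v3 ^ 2 ≠ 0)
    (h1 : u2 * v3 - u3 * v2 = 0) (h2 : u3 * v1 - u1 * v3 = 0) (h3 : u1 * v2 - u2 * v1 = 0) :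
    u1 = v1 ∧ u2 = v2 ∧ u3 = v3 := by
  have du : 2 * (n1 * u1 + n2 * u2 + n3 * u3) = -(u1 ^ 2 + u2 ^ 2 + u3 ^ 2) := by linarith
  have dv : 2 * (n1 * v1 + n2 * v2 + n3 * v3) = -(v1 ^ 2 + v2 ^ 2 + v3 ^ 2) := by linarith
  have e1 : (u1 ^ 2 + u2 ^ 2 + u3 ^ 2) * (v1 ^ 2 + v2 ^ 2 + v3 ^ 2)
      = (u1 ^ 2 + u2 ^ 2 + u3 ^ 2) * (u1 * v1 + u2 * v2 + u3 * v3) := by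
    linear_combination (u1 ^ 2 + u2 ^ 2 + u3 ^ 2) * dv - (u1 * v1 + u2 * v2 + u3 * v3) * du
      - 2 * (n1 * (u3 * h2 - u2 * h3) + n2 * (u1 * h3 - u3 * h1) + n3 * (u2 * h1 - u1 * h2))
  have e2 : (v1 ^ 2 + v2 ^ 2 + v3 ^ 2) * (u1 ^ 2 + u2 ^ 2 + u3 ^ 2)
      = (v1 ^ 2 + v2 ^ 2 + v3 ^ 2) * (u1 * v1 + u2 * v2 + u3 * v3) := by
    linear_combination (v1 ^ 2 + v2 ^ 2 + v3 ^ 2) * du - (u1 * v1 + u2 * v2 + u3 * v3) * dv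
      + 2 * (n1 * (v3 * h2 - v2 * h3) + n2 * (v1 * h3 - v3 * h1) + n3 * (v2 * h1 - v1 * h2))
  have f1 := mul_left_cancel₀ hu e1
  have f2 := mul_left_cancel₀ hv e2
  obtain ⟨g1, g2, g3⟩ := sq3 (a := u1 - v1) (b := u2 - v2) (c := u3 - v3) (by linarith)
  exact ⟨by linarith, by linarith, by linarith⟩

set_option maxHeartbeats 1000000 in
lemma cell (δ C lam : ℝ) (hδ : 0 < δ) (hC : 1 ≤ C)
    (hdiv : ∀ n : ℕ, n ≠ 0 → (n.divisors.card : ℝ) ≤ C * (n : ℝ) ^ δ) (hl : 1 < lam)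
    (s : Finset (Fin 3 → ℤ))
    (hs : ∀ n ∈ s, (n 0 : ℝ) ^ 2 + (n 1 : ℝ) ^ 2 + (n 2 : ℝ) ^ 2 = lam ^ 2)
    (hd : ∀ n ∈ s, ∀ n' ∈ s, ((n 0 : ℝ) - n' 0) ^ 2 + ((n 1 : ℝ) - n' 1) ^ 2
      + ((n 2 : ℝ) - n' 2) ^ 2 ≤ √lam / 3) :
    (s.card : ℝ) ≤ 10 * (C * (lam ^ 5) ^ δ) ^ 3 := by
  have hone : 1 ≤ (C * (lam ^ 5) ^ δ) ^ 3 := by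
    apply one_le_pow₀
    exact one_le_mul_of_one_le_of_one_le hC (Real.one_le_rpow (one_le_pow₀ hl.le) hδ.le)
  by_cases hc : s.card ≤ 2
  · have : (s.card : ℝ) ≤ 2 := by exact_mod_cast hc
    linarith
  obtain ⟨n0, m0, n1, m1, n2, m2, h01, h02, h12⟩ := Finset.two_lt_card.mp (not_le.mp hc)
  have hext : ∀ n n' : Fin 3 → ℤ, n 0 = n' 0 → n 1 = n' 1 → n 2 = n' 2 → n = n' := by
    intro n n' a b c; ext i; fin_cases i <;> assumption
  set M : ℤ := n0 0 ^ 2 + n0 1 ^ 2 + n0 2 ^ 2 with hM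
  have hMl : (M : ℝ) = lam ^ 2 := by rw [hM]; push_cast; exact hs _ m0
  have hsM : ∀ n ∈ s, n 0 ^ 2 + n 1 ^ 2 + n 2 ^ 2 = M := by
    intro n hn
    have := (hs n hn).trans hMl.symm
    exact_mod_cast this
  clear_value M
  obtain ⟨u1, hu1⟩ : ∃ x, x = n1 0 - n0 0 := ⟨_, rfl⟩
  obtain ⟨u2, hu2⟩ : ∃ x, x = n1 1 - n0 1 := ⟨_, rfl⟩
  obtain ⟨u3, hu3⟩ : ∃ x, x = n1 2 - n0 2 := ⟨_, rfl⟩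
  obtain ⟨v1, hv1⟩ : ∃ x, x = n2 0 - n0 0 := ⟨_, rfl⟩
  obtain ⟨v2, hv2⟩ : ∃ x, x = n2 1 - n0 1 := ⟨_, rfl⟩
  obtain ⟨v3, hv3⟩ : ∃ x, x = n2 2 - n0 2 := ⟨_, rfl⟩
  obtain ⟨a1, ha1⟩ : ∃ x, x = u2 * v3 - u3 * v2 := ⟨_, rfl⟩
  obtain ⟨a2, ha2⟩ : ∃ x, x = u3 * v1 - u1 * v3 := ⟨_, rfl⟩
  obtain ⟨a3, ha3⟩ : ∃ x, x = u1 * v2 - u2 * v1 := ⟨_, rfl⟩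
  have hρ4 : (√lam / 3) ^ 4 = lam ^ 2 / 81 := by
    have : √lam ^ 2 = lam := Real.sq_sqrt (by linarith)
    rw [div_pow, show √lam ^ 4 = (√lam ^ 2) ^ 2 by ring, this]; norm_num
  have hρl : √lam / 3 ≤ lam := by
    have : √lam ≤ lam := by
      rw [Real.sqrt_le_left (by linarith)]; exact le_self_pow₀ hl.le two_ne_zero
    linarith
  have hu : u1 ^ 2 + u2 ^ 2 + u3 ^ 2 ≠ 0 := by
    intro h
    obtain ⟨x, y, z⟩ := sq3 h
    exact h01 (hext _ _ (by omega) (by omega) (by omega))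
  have hv : v1 ^ 2 + v2 ^ 2 + v3 ^ 2 ≠ 0 := by
    intro h
    obtain ⟨x, y, z⟩ := sq3 h
    exact h02 (hext _ _ (by omega) (by omega) (by omega))
  have ha : a1 ^ 2 + a2 ^ 2 + a3 ^ 2 ≠ 0 := by
    intro h
    obtain ⟨x, y, z⟩ := sq3 h
    obtain ⟨x', y', z'⟩ := noncol (n0 0) (n0 1) (n0 2) u1 u2 u3 v1 v2 v3 M (hsM _ m0)
      (by rw [hu1, hu2, hu3, ← hsM _ m1]; ring) (by rw [hv1, hv2, hv3, ← hsM _ m2]; ring)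
      hu hv (by linarith) (by linarith) (by linarith)
    exact h12 (hext _ _ (by omega) (by omega) (by omega))
  have hau : a1 * u1 + a2 * u2 + a3 * u3 = 0 := by rw [ha1, ha2, ha3]; ring
  obtain ⟨b, hb⟩ : ∃ x, x = n0 0 * a1 + n0 1 * a2 + n0 2 * a3 := ⟨_, rfl⟩
  have hur : (u1 : ℝ) ^ 2 + (u2 : ℝ) ^ 2 + (u3 : ℝ) ^ 2 ≤ √lam / 3 := by
    rw [hu1, hu2, hu3]; push_cast; exact hd _ m1 _ m0
  have hvr : (v1 : ℝ) ^ 2 + (v2 : ℝ) ^ 2 + (v3 : ℝ) ^ 2 ≤ √lam / 3 := by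
    rw [hv1, hv2, hv3]; push_cast; exact hd _ m2 _ m0
  have hplane : ∀ n ∈ s, n 0 * a1 + n 1 * a2 + n 2 * a3 = b := by
    intro n hn
    have h := det_small (n0 0) (n0 1) (n0 2) u1 u2 u3 v1 v2 v3
      ((n 0 : ℝ) - n0 0) ((n 1 : ℝ) - n0 1) ((n 2 : ℝ) - n0 2) (√lam / 3) (lam ^ 2) (hs _ m0)
      (by rw [hu1, hu2, hu3, ← hs _ m1]; push_cast; ring)
      (by rw [hv1, hv2, hv3, ← hs _ m2]; push_cast; ring)
      (by rw [← hs _ hn]; ring) hur hvr (hd _ hn _ m0)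
    rw [hρ4] at h
    obtain ⟨d, hdd⟩ : ∃ x, x = (n 0 - n0 0) * a1 + (n 1 - n0 1) * a2 + (n 2 - n0 2) * a3 := ⟨_, rfl⟩
    have h' : (d : ℝ) ^ 2 * lam ^ 2 ≤ 9 / 4 * (lam ^ 2 / 81) := by
      refine le_trans (le_of_eq ?_) h
      rw [hdd, ha1, ha2, ha3]; push_cast; ring
    have hl2 : 0 < lam ^ 2 := by positivity
    have h'' : (d : ℝ) ^ 2 < 1 := by
      refine lt_of_mul_lt_mul_right ?_ hl2.le
      linarith only [h', hl2]
    have h3 : d ^ 2 < 1 := by exact_mod_cast h''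
    have h4 : d = 0 := by
      rw [← sq_eq_zero_iff]; have := sq_nonneg d; omega
    rw [hb]; linarith
  obtain ⟨N, hN⟩ : ∃ x, x = (u1 ^ 2 + u2 ^ 2 + u3 ^ 2) * ((a1 ^ 2 + a2 ^ 2 + a3 ^ 2) * M - b ^ 2) :=
    ⟨_, rfl⟩
  have hS : 0 < a1 ^ 2 + a2 ^ 2 + a3 ^ 2 := lt_of_le_of_ne (by positivity) ha.symm
  have hE : 0 < u1 ^ 2 + u2 ^ 2 + u3 ^ 2 := lt_of_le_of_ne (by positivity) hu.symm
  let F : (Fin 3 → ℤ) → ℤ × ℤ := fun n =>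
    (n 0 * (a2 * u3 - a3 * u2) + n 1 * (a3 * u1 - a1 * u3) + n 2 * (a1 * u2 - a2 * u1),
     n 0 * u1 + n 1 * u2 + n 2 * u3)
  have hF : ∀ n ∈ s, (F n).1 ^ 2 + (a1 ^ 2 + a2 ^ 2 + a3 ^ 2) * (F n).2 ^ 2 = N := by
    intro n hn
    rw [hN, ← hplane n hn, ← hsM n hn]
    exact gram _ _ _ _ _ _ _ _ _ hau
  have hinj : Set.InjOn F s := by
    intro n hn n' hn' heq
    have p := hplane n hn
    have p' := hplane n' hn'
    have q1 : (F n).1 = (F n').1 := by rw [heq]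
    have q2 : (F n).2 = (F n').2 := by rw [heq]
    simp only [F] at q1 q2
    have g := gram (n 0 - n' 0) (n 1 - n' 1) (n 2 - n' 2) _ _ _ _ _ _ hau
    have z1 : (n 0 - n' 0) * (a2 * u3 - a3 * u2) + (n 1 - n' 1) * (a3 * u1 - a1 * u3)
      + (n 2 - n' 2) * (a1 * u2 - a2 * u1) = 0 := by linarith
    have z2 : (n 0 - n' 0) * u1 + (n 1 - n' 1) * u2 + (n 2 - n' 2) * u3 = 0 := by linarith
    have z3 : (n 0 - n' 0) * a1 + (n 1 - n' 1) * a2 + (n 2 - n' 2) * a3 = 0 := by linarith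
    rw [z1, z2, z3] at g
    have g' : (u1 ^ 2 + u2 ^ 2 + u3 ^ 2) * ((a1 ^ 2 + a2 ^ 2 + a3 ^ 2) *
      ((n 0 - n' 0) ^ 2 + (n 1 - n' 1) ^ 2 + (n 2 - n' 2) ^ 2)) = 0 := by linarith
    obtain ⟨x, y, z⟩ := sq3 (((mul_eq_zero.mp g').resolve_left hu |> mul_eq_zero.mp).resolve_left ha)
    exact hext _ _ (by omega) (by omega) (by omega)
  have hN0 : 0 ≤ N := by rw [← hF n0 m0]; positivity
  rcases hN0.eq_or_lt with hz | hpos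
  · exfalso
    have hzero : ∀ n ∈ s, F n = (0, 0) := by
      intro n hn
      have h := hF n hn
      rw [← hz] at h
      obtain ⟨h1, h2⟩ := sqD hS h
      exact Prod.ext h1 h2
    exact h01 (hinj m0 m1 ((hzero _ m0).trans (hzero _ m1).symm))
  have hNl : (N : ℝ) ≤ lam ^ 5 := by
    have hSr : (a1 : ℝ) ^ 2 + (a2 : ℝ) ^ 2 + (a3 : ℝ) ^ 2 ≤ lam ^ 2 := by
      have := lagr _ _ _ _ _ _ lam (hur.trans hρl) (hvr.trans hρl)
      rw [ha1, ha2, ha3]; push_cast; exact this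
    rw [hN]; push_cast; rw [hMl]
    calc _ ≤ ((u1 : ℝ) ^ 2 + (u2 : ℝ) ^ 2 + (u3 : ℝ) ^ 2) *
          (((a1 : ℝ) ^ 2 + (a2 : ℝ) ^ 2 + (a3 : ℝ) ^ 2) * lam ^ 2) := by
          gcongr; have := sq_nonneg (b : ℝ); linarith
      _ ≤ lam * (lam ^ 2 * lam ^ 2) := by
          gcongr
          exact hur.trans hρl
      _ = _ := by ring
  lift N to ℕ using hN0
  have hpos' : 0 < N := by exact_mod_cast hpos
  have hcard := formD (a1 ^ 2 + a2 ^ 2 + a3 ^ 2) N hS hpos' (s.image F) (by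
    intro p hp
    obtain ⟨n, hn, rfl⟩ := Finset.mem_image.mp hp
    exact hF n hn)
  rw [Finset.card_image_of_injOn hinj] at hcard
  have hcr : (s.card : ℝ) ≤ 10 * (N.divisors.card : ℝ) ^ 3 := by
    have : (s.card : ℝ) ≤ ((10 * N.divisors.card * N.divisors.card * N.divisors.card : ℕ) : ℝ) := by
      exact_mod_cast hcard
    refine this.trans (le_of_eq ?_)
    push_cast; ring
  refine hcr.trans ?_
  have := hdiv N hpos'.ne'
  have hNl' : (N : ℝ) ≤ lam ^ 5 := by exact_mod_cast hNl
  have : (N.divisors.card : ℝ) ≤ C * (lam ^ 5) ^ δ := this.trans (by gcongr)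
  gcongr

theorem stmt17 (ε : ℝ) (hε : 0 < ε) :
    ∃ C : ℝ, 0 < C ∧
      ∀ (lam : ℝ), 1 < lam →
        ∀ (ζ : Fin 3 → ℝ),
          (Set.ncard {n : Fin 3 → ℤ |
              (∑ i, ((n i : ℝ)) ^ 2) = lam ^ 2 ∧
              (∑ i, ((n i : ℝ) - ζ i) ^ 2) ≤ Real.sqrt lam} : ℝ)
            ≤ C * lam ^ ε := by
  obtain ⟨C, hC, hdiv⟩ := div_bound (ε / 15) (by positivity)
  refine ⟨3430 * C ^ 3, by positivity, fun lam hl ζ => ?_⟩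
  have hl0 : 0 < lam := by linarith
  have hpow : 10 * (C * (lam ^ 5) ^ (ε / 15)) ^ 3 = 10 * C ^ 3 * lam ^ ε := by
    have : ((lam ^ 5) ^ (ε / 15)) ^ 3 = lam ^ ε := by
      rw [← Real.rpow_natCast, ← Real.rpow_natCast, ← Real.rpow_mul hl0.le, ← Real.rpow_mul hl0.le]
      congr 1; push_cast; ring
    rw [mul_pow, this]; ring
  set T := {n : Fin 3 → ℤ | (∑ i, ((n i : ℝ)) ^ 2) = lam ^ 2 ∧
              (∑ i, ((n i : ℝ) - ζ i) ^ 2) ≤ Real.sqrt lam} with hT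
  by_cases hfin : T.Finite
  swap
  · rw [Set.Infinite.ncard hfin]; push_cast; positivity
  rw [Set.ncard_eq_toFinset_card T hfin]
  set s := hfin.toFinset with hs
  have hmem : ∀ n ∈ s, ((n 0 : ℝ) ^ 2 + (n 1 : ℝ) ^ 2 + (n 2 : ℝ) ^ 2 = lam ^ 2) ∧
      (((n 0 : ℝ) - ζ 0) ^ 2 + ((n 1 : ℝ) - ζ 1) ^ 2 + ((n 2 : ℝ) - ζ 2) ^ 2 ≤ √lam) := by
    intro n hn
    rw [hs, Set.Finite.mem_toFinset, hT] at hn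
    simpa [Fin.sum_univ_three] using hn
  obtain ⟨r, hr⟩ : ∃ x, x = √√lam := ⟨_, rfl⟩
  have hr0 : 0 < r := by rw [hr]; positivity
  have hr2 : r ^ 2 = √lam := by rw [hr]; exact Real.sq_sqrt (by positivity)
  let f : (Fin 3 → ℤ) → ℤ × ℤ × ℤ := fun n =>
    (⌊3 * ((n 0 : ℝ) - ζ 0) / r⌋, ⌊3 * ((n 1 : ℝ) - ζ 1) / r⌋, ⌊3 * ((n 2 : ℝ) - ζ 2) / r⌋)
  let I := Finset.Icc (-3 : ℤ) 3
  have hI : ∀ x : ℝ, x ^ 2 ≤ √lam → ⌊3 * x / r⌋ ∈ I := by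
    intro x hx
    rw [← hr2] at hx
    have := abs_le_of_sq_le_sq' hx hr0.le
    rw [Finset.mem_Icc]
    constructor
    · rw [Int.le_floor, le_div_iff₀ hr0]; push_cast; linarith
    · have : ((⌊3 * x / r⌋ : ℤ) : ℝ) ≤ 3 :=
        (Int.floor_le _).trans (by rw [div_le_iff₀ hr0]; linarith)
      exact_mod_cast this
  have hfib : ∀ k, ((s.filter (fun n => f n = k)).card : ℝ) ≤ 10 * C ^ 3 * lam ^ ε := by
    intro k
    rw [← hpow]
    apply cell (ε / 15) C lam (by positivity) hC hdiv hl
    · intro n hn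
      exact (hmem n (Finset.mem_filter.mp hn).1).1
    · intro n hn n' hn'
      have e : f n = f n' := (Finset.mem_filter.mp hn).2.trans (Finset.mem_filter.mp hn').2.symm
      simp only [f, Prod.mk.injEq] at e
      have hcl : ∀ x y z : ℝ, ⌊3 * (x - z) / r⌋ = ⌊3 * (y - z) / r⌋ → (x - y) ^ 2 ≤ r ^ 2 / 9 := by
        intro x y z h
        have h1 := Int.abs_sub_lt_one_of_floor_eq_floor h
        have h2 : 3 * (x - z) / r - 3 * (y - z) / r = 3 * (x - y) / r := by ring
        rw [h2, abs_div, abs_of_pos hr0, div_lt_one hr0] at h1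
        have := abs_lt.mp h1
        nlinarith
      have := hcl _ _ _ e.1
      have := hcl _ _ _ e.2.1
      have := hcl _ _ _ e.2.2
      rw [← hr2]; linarith
  have hmaps : ∀ n ∈ s, f n ∈ I ×ˢ I ×ˢ I := by
    intro n hn
    have h := (hmem n hn).2
    have p0 := sq_nonneg ((n 0 : ℝ) - ζ 0)
    have p1 := sq_nonneg ((n 1 : ℝ) - ζ 1)
    have p2 := sq_nonneg ((n 2 : ℝ) - ζ 2)
    exact Finset.mem_product.mpr ⟨hI _ (by linarith), Finset.mem_product.mpr
      ⟨hI _ (by linarith), hI _ (by linarith)⟩⟩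
  rw [Finset.card_eq_sum_card_fiberwise (f := f) (t := I ×ˢ I ×ˢ I) hmaps]
  push_cast
  refine (Finset.sum_le_card_nsmul _ _ _ (fun k _ => hfib k)).trans (le_of_eq ?_)
  have : (I ×ˢ I ×ˢ I).card = 343 := by simp [I]
  rw [this, nsmul_eq_mul]; push_cast; ring
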